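/- arXiv:1810.09114 — 7 statements merged into one kernel-verified Lean document; each statement's English description precedes it below -/
import Mathlib

section
/- Let n ≥ 1 and p ∈ ℕ₀. Then there exists a constant C > 0 such that for all t > 0: ( ∫_{|ξ|≤1} | E₁(t,ξ) − Σ_{k=0}^{p} e₁^k(t,ξ) |² dξ )^{1/2} ≤ C (1+t)^{−n/4−p/2}. -/
open MeasureTheory Filter

noncomputable section

/-- Euclidean space `ℝⁿ`. -/
abbrev Rn (n : ℕ) := EuclideanSpace ℝ (Fin n)

/-- Fourier transform `f̂(ξ) = ∫ e^{-i x·ξ} f(x) dx` of a real-valued `f`. -/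
def fourierHat (n : ℕ) (f : Rn n → ℝ) (ξ : Rn n) : ℂ :=
  ∫ x : Rn n, Complex.exp (-Complex.I * ((∑ i, x i * ξ i : ℝ) : ℂ)) * (f x : ℂ)

/-- Membership in the weighted space `L^{1,γ}(ℝⁿ)`. -/
def MemL1w (n : ℕ) (γ : ℝ) (f : Rn n → ℝ) : Prop :=
  MeasureTheory.Integrable f ∧
    MeasureTheory.Integrable (fun x : Rn n => (1 + ‖x‖) ^ γ * |f x|)

/-- The weighted norm `‖f‖_{1,γ}`. -/
def wnorm (n : ℕ) (γ : ℝ) (f : Rn n → ℝ) : ℝ :=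
  ∫ x : Rn n, (1 + ‖x‖) ^ γ * |f x|

/-- The evolution operator multiplier `E₀(t,ξ)`. -/
def E0 (n : ℕ) (t : ℝ) (ξ : Rn n) : ℝ :=
  if ‖ξ‖ ≤ 2 then
    Real.exp (-(t * ‖ξ‖ ^ 2) / 2) * Real.cos (t * ‖ξ‖ * Real.sqrt (4 - ‖ξ‖ ^ 2) / 2)
  else
    Real.exp (-(t * ‖ξ‖ ^ 2) / 2) * Real.cosh (t * ‖ξ‖ * Real.sqrt (‖ξ‖ ^ 2 - 4) / 2)

/-- The evolution operator multiplier `E₁(t,ξ)`. -/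
def E1 (n : ℕ) (t : ℝ) (ξ : Rn n) : ℝ :=
  if ‖ξ‖ ≤ 2 then
    Real.exp (-(t * ‖ξ‖ ^ 2) / 2) *
      (Real.sin (t * ‖ξ‖ * Real.sqrt (4 - ‖ξ‖ ^ 2) / 2) /
        (‖ξ‖ * Real.sqrt (4 - ‖ξ‖ ^ 2) / 2))
  else
    Real.exp (-(t * ‖ξ‖ ^ 2) / 2) *
      (Real.sinh (t * ‖ξ‖ * Real.sqrt (‖ξ‖ ^ 2 - 4) / 2) /
        (‖ξ‖ * Real.sqrt (‖ξ‖ ^ 2 - 4) / 2))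

/-- `L₀(a,t,ξ)` as a function of `a`. -/
def L0fun (n : ℕ) (t : ℝ) (ξ : Rn n) (a : ℝ) : ℝ :=
  Real.cos (t * ‖ξ‖ - t * ‖ξ‖ ^ 2 * (a / (4 + 2 * Real.sqrt (4 - a ^ 2))))

/-- `L₁(a,t,ξ)` as a function of `a`. -/
def L1fun (n : ℕ) (t : ℝ) (ξ : Rn n) (a : ℝ) : ℝ :=
  Real.sin (t * ‖ξ‖ - t * ‖ξ‖ ^ 2 * (a / (4 + 2 * Real.sqrt (4 - a ^ 2)))) /
    (‖ξ‖ * Real.sqrt (4 - a ^ 2) / 2)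

/-- `e₀^k(t,ξ) = e^{-t|ξ|²/2} (1/k!) (∂^k L₀/∂a^k)(0,t,ξ) |ξ|^k`. -/
def e0 (n : ℕ) (k : ℕ) (t : ℝ) (ξ : Rn n) : ℝ :=
  Real.exp (-(t * ‖ξ‖ ^ 2) / 2) * ((1 : ℝ) / k.factorial) *
    iteratedDeriv k (L0fun n t ξ) 0 * ‖ξ‖ ^ k

/-- `e₁^k(t,ξ) = e^{-t|ξ|²/2} (1/k!) (∂^k L₁/∂a^k)(0,t,ξ) |ξ|^k`. -/
def e1 (n : ℕ) (k : ℕ) (t : ℝ) (ξ : Rn n) : ℝ :=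
  Real.exp (-(t * ‖ξ‖ ^ 2) / 2) * ((1 : ℝ) / k.factorial) *
    iteratedDeriv k (L1fun n t ξ) 0 * ‖ξ‖ ^ k

/-- The moment polynomial
`m[f]^k(ξ) = ∑_{|α|=k} ((-1)^{|α|}/α!) (∫ x^α f(x) dx) (iξ)^α`. -/
def mom (n : ℕ) (f : Rn n → ℝ) (k : ℕ) (ξ : Rn n) : ℂ :=
  ∑ α ∈ Finset.univ.filter (fun α : Fin n → Fin (k + 1) => ∑ i, (α i).val = k),
    ((-1 : ℂ) ^ k / ∏ i, ((α i).val.factorial : ℂ)) *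
      ((∫ x : Rn n, (∏ i, x i ^ (α i).val) * f x : ℝ) : ℂ) *
      ∏ i, (Complex.I * (ξ i : ℂ)) ^ (α i).val

/-- The Fourier-space solution of the strongly damped wave equation. -/
def uhat (n : ℕ) (u₀ u₁ : Rn n → ℝ) (t : ℝ) (ξ : Rn n) : ℂ :=
  (E0 n t ξ : ℂ) * fourierHat n u₀ ξ +
    (E1 n t ξ : ℂ) * (((‖ξ‖ ^ 2 / 2 : ℝ) : ℂ) * fourierHat n u₀ ξ + fourierHat n u₁ ξ)

open Set Real in
/-- Derivatives of an oscillating function `sin (x - y h) g` grow at most polynomially in `y`,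
uniformly in the phase `x`. -/
theorem exists_abs_iteratedDerivWithin_sin_mul_le {s : Set ℝ} (hs : UniqueDiffOn ℝ s)
    (hc : IsCompact s) {h : ℝ → ℝ} (hh : ContDiffOn ℝ ⊤ h s) (k : ℕ) :
    ∀ g : ℝ → ℝ, ContDiffOn ℝ ⊤ g s → ∃ C : ℝ, 0 ≤ C ∧ ∀ x y : ℝ, ∀ a ∈ s,
      |iteratedDerivWithin k (fun a => sin (x - y * h a) * g a) s a| ≤ C * (1 + |y|) ^ k := by
  induction k with
  | zero =>
    intro g hg
    obtain ⟨C, hC⟩ := hc.exists_bound_of_continuousOn hg.continuousOn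
    refine ⟨|C|, abs_nonneg C, fun x y a ha => ?_⟩
    rw [iteratedDerivWithin_zero, abs_mul, pow_zero, mul_one]
    calc _ ≤ 1 * |g a| := by gcongr; exact abs_sin_le_one _
      _ ≤ |C| := by rw [one_mul]; exact (hC a ha).trans (le_abs_self C)
  | succ k ih =>
    intro g hg
    have hg' : ContDiffOn ℝ ⊤ (derivWithin g s) s := hg.derivWithin hs le_rfl
    have hh' : ContDiffOn ℝ ⊤ (derivWithin h s) s := hh.derivWithin hs le_rfl
    obtain ⟨A, hA0, hA⟩ := ih _ hg'
    obtain ⟨B, hB0, hB⟩ := ih _ (hh'.mul hg)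
    refine ⟨A + B, by positivity, fun x y a ha => ?_⟩
    have hsmooth : ∀ (x : ℝ) (g : ℝ → ℝ), ContDiffOn ℝ ⊤ g s →
        ContDiffOn ℝ k (fun a => sin (x - y * h a) * g a) s := fun x g hg =>
      ((contDiff_sin.comp_contDiffOn (contDiffOn_const.sub (contDiffOn_const.mul hh))).mul
        hg).of_le (by exact_mod_cast le_top)
    have hderiv : EqOn (derivWithin (fun a => sin (x - y * h a) * g a) s)
        ((fun a => sin (x - y * h a) * derivWithin g s a) +
          (-y) • (fun a => sin ((x + π / 2) - y * h a) * (derivWithin h s a * g a))) s := by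
      intro b hb
      have hdh := ((hh b hb).differentiableWithinAt (by simp)).hasDerivWithinAt
      have hdg := ((hg b hb).differentiableWithinAt (by simp)).hasDerivWithinAt
      have := ((hdh.const_mul y).const_sub x).sin.mul hdg
      refine (this.derivWithin (hs b hb)).trans ?_
      have hcos : sin ((x + π / 2) - y * h b) = cos (x - y * h b) := by
        rw [← sin_add_pi_div_two]; ring_nf
      simp only [Pi.add_apply, Pi.smul_apply, smul_eq_mul, hcos]
      ring
    have hsmul : ContDiffWithinAt ℝ k
        ((-y) • (fun a => sin ((x + π / 2) - y * h a) * (derivWithin h s a * g a))) s a :=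
      (hsmooth (x + π / 2) _ (hh'.mul hg) a ha).const_smul (-y)
    rw [iteratedDerivWithin_succ', iteratedDerivWithin_congr hderiv ha,
      iteratedDerivWithin_add ha hs (hsmooth x _ hg' a ha) hsmul,
      iteratedDerivWithin_const_smul_field]
    have h1 := hA x y a ha
    have h2 := hB (x + π / 2) y a ha
    calc _ ≤ A * (1 + |y|) ^ k + |y| * (B * (1 + |y|) ^ k) := by
          refine (abs_add_le _ _).trans (add_le_add h1 ?_)
          rw [smul_eq_mul, abs_mul, abs_neg]
          exact mul_le_mul_of_nonneg_left h2 (abs_nonneg y)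
      _ ≤ (A + B) * (1 + |y|) ^ (k + 1) := by
          have := abs_nonneg y
          have : 0 ≤ A * (1 + |y|) ^ k * |y| + B * (1 + |y|) ^ k := by positivity
          rw [pow_succ]; linarith

theorem contDiffAt_sqrt_four_sub_sq {a : ℝ} (ha : |a| < 2) :
    ContDiffAt ℝ ⊤ (fun a : ℝ => Real.sqrt (4 - a ^ 2)) a := by
  refine (contDiffAt_const.sub (contDiffAt_id.pow 2)).sqrt ?_
  have := abs_lt.1 ha
  simp only [id]
  nlinarith

theorem sqrt_four_sub_sq_pos {a : ℝ} (ha : |a| < 2) : 0 < Real.sqrt (4 - a ^ 2) := by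
  have := abs_lt.1 ha
  exact Real.sqrt_pos.2 (by nlinarith)

theorem contDiffAt_phase {a : ℝ} (ha : |a| < 2) :
    ContDiffAt ℝ ⊤ (fun a : ℝ => a / (4 + 2 * Real.sqrt (4 - a ^ 2))) a :=
  contDiffAt_id.div
    (contDiffAt_const.add (contDiffAt_const.mul (contDiffAt_sqrt_four_sub_sq ha)))
    (by have := sqrt_four_sub_sq_pos ha; positivity)

theorem contDiffAt_amplitude {a : ℝ} (ha : |a| < 2) :
    ContDiffAt ℝ ⊤ (fun a : ℝ => 2 / Real.sqrt (4 - a ^ 2)) a :=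
  contDiffAt_const.div (contDiffAt_sqrt_four_sub_sq ha) (sqrt_four_sub_sq_pos ha).ne'

theorem L1fun_eq_smul (n : ℕ) (t : ℝ) (ξ : Rn n) :
    L1fun n t ξ = ‖ξ‖⁻¹ • fun a => Real.sin (t * ‖ξ‖ -
      (t * ‖ξ‖ ^ 2) * (a / (4 + 2 * Real.sqrt (4 - a ^ 2)))) * (2 / Real.sqrt (4 - a ^ 2)) := by
  funext a
  simp only [L1fun, Pi.smul_apply, smul_eq_mul, div_eq_mul_inv, mul_inv, inv_inv]
  ring

theorem contDiffAt_oscillation (x y : ℝ) {a : ℝ} (ha : |a| < 2) :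
    ContDiffAt ℝ ⊤ (fun a => Real.sin (x - y * (a / (4 + 2 * Real.sqrt (4 - a ^ 2)))) *
      (2 / Real.sqrt (4 - a ^ 2))) a :=
  (contDiffAt_const.sub (contDiffAt_const.mul (contDiffAt_phase ha))).sin.mul
    (contDiffAt_amplitude ha)

theorem E1_eq_exp_mul_L1fun (n : ℕ) (t : ℝ) {ξ : Rn n} (hξ : ‖ξ‖ ≤ 1) :
    E1 n t ξ = Real.exp (-(t * ‖ξ‖ ^ 2) / 2) * L1fun n t ξ ‖ξ‖ := by
  have h0 := norm_nonneg ξ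
  rw [E1, if_pos (by linarith), L1fun]
  set r := ‖ξ‖
  have hsq : Real.sqrt (4 - r ^ 2) ^ 2 = 4 - r ^ 2 := Real.sq_sqrt (by nlinarith)
  have hs := Real.sqrt_nonneg (4 - r ^ 2)
  set s := Real.sqrt (4 - r ^ 2)
  have : t * r * s / 2 = t * r - t * r ^ 2 * (r / (4 + 2 * s)) := by
    have : (4 + 2 * s) ≠ 0 := by positivity
    field_simp
    linear_combination 2 * t * r * hsq
  rw [this]

theorem exists_abs_E1_sub_sum_e1_le (n p : ℕ) :
    ∃ M : ℝ, 0 ≤ M ∧ ∀ t : ℝ, 0 ≤ t → ∀ ξ : Rn n, ‖ξ‖ ≤ 1 →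
      |E1 n t ξ - ∑ k ∈ Finset.range (p + 1), e1 n k t ξ| ≤
        M * ‖ξ‖ ^ p * (1 + t * ‖ξ‖ ^ 2) ^ (p + 1) * Real.exp (-(t * ‖ξ‖ ^ 2) / 2) := by
  have hI : ∀ a ∈ Set.Icc (0 : ℝ) 1, |a| < 2 := fun a ha => by
    rw [abs_of_nonneg ha.1]; linarith [ha.2]
  have hu : UniqueDiffOn ℝ (Set.Icc (0 : ℝ) 1) := uniqueDiffOn_Icc zero_lt_one
  obtain ⟨C, hC0, hC⟩ := exists_abs_iteratedDerivWithin_sin_mul_le hu isCompact_Icc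
    (fun a ha => (contDiffAt_phase (hI a ha)).contDiffWithinAt) (p + 1) _
    (fun a ha => (contDiffAt_amplitude (hI a ha)).contDiffWithinAt)
  refine ⟨C / p.factorial, by positivity, fun t ht ξ hξ => ?_⟩
  have h0 := norm_nonneg ξ
  set F : ℝ → ℝ := fun a => Real.sin (t * ‖ξ‖ -
      (t * ‖ξ‖ ^ 2) * (a / (4 + 2 * Real.sqrt (4 - a ^ 2)))) * (2 / Real.sqrt (4 - a ^ 2))
    with hF
  have hL : L1fun n t ξ = ‖ξ‖⁻¹ • F := L1fun_eq_smul n t ξ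
  have hFs : ∀ a ∈ Set.Icc (0 : ℝ) 1, ContDiffAt ℝ ⊤ F a := fun a ha =>
    contDiffAt_oscillation _ _ (hI a ha)
  have htaylor := taylor_mean_remainder_bound (f := F) (n := p) zero_le_one
    (fun a ha => ((hFs a ha).of_le (by exact_mod_cast le_top)).contDiffWithinAt) ⟨h0, hξ⟩
    (fun a ha => hC (t * ‖ξ‖) (t * ‖ξ‖ ^ 2) a ha)
  have hy : |t * ‖ξ‖ ^ 2| = t * ‖ξ‖ ^ 2 := abs_of_nonneg (by positivity)
  rw [Real.norm_eq_abs, sub_zero, hy] at htaylor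
  have hsum : E1 n t ξ - ∑ k ∈ Finset.range (p + 1), e1 n k t ξ =
      Real.exp (-(t * ‖ξ‖ ^ 2) / 2) * ‖ξ‖⁻¹ *
        (F ‖ξ‖ - taylorWithinEval F p (Set.Icc 0 1) 0 ‖ξ‖) := by
    rw [E1_eq_exp_mul_L1fun n t hξ, taylor_within_apply, mul_sub, Finset.mul_sum, hL]
    congr 1
    · simp only [Pi.smul_apply, smul_eq_mul]; ring
    · refine Finset.sum_congr rfl fun k _ => ?_
      have hm : (0 : ℝ) ∈ Set.Icc (0 : ℝ) 1 := ⟨le_rfl, zero_le_one⟩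
      have hk : ContDiffAt ℝ k F 0 := (hFs 0 hm).of_le (by exact_mod_cast le_top)
      rw [e1, hL, iteratedDerivWithin_eq_iteratedDeriv hu hk hm,
        iteratedDeriv_const_smul_field]
      simp only [smul_eq_mul, sub_zero, one_div]
      ring
  rw [hsum, abs_mul, abs_of_nonneg (by positivity)]
  refine (mul_le_mul_of_nonneg_left htaylor (by positivity)).trans ?_
  have hr : ‖ξ‖⁻¹ * ‖ξ‖ ^ (p + 1) ≤ ‖ξ‖ ^ p := by
    rcases h0.eq_or_lt with h | h
    · rw [← h]; simp
    · rw [pow_succ]; field_simp; rfl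
  have hpos : 0 ≤ Real.exp (-(t * ‖ξ‖ ^ 2) / 2) * (C / p.factorial) *
    (1 + t * ‖ξ‖ ^ 2) ^ (p + 1) := by positivity
  calc _ = Real.exp (-(t * ‖ξ‖ ^ 2) / 2) * (C / p.factorial) *
    (1 + t * ‖ξ‖ ^ 2) ^ (p + 1) * (‖ξ‖⁻¹ * ‖ξ‖ ^ (p + 1)) := by ring
    _ ≤ _ := mul_le_mul_of_nonneg_left hr hpos
    _ = _ := by ring

theorem one_add_pow_mul_exp_neg_le (m : ℕ) {z : ℝ} (hz : 0 ≤ z) :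
    (1 + z) ^ m * Real.exp (-z) ≤ 2 ^ m * m.factorial * Real.exp 1 * Real.exp (-(z / 2)) := by
  have h := Real.pow_div_factorial_le_exp ((1 + z) / 2) (by positivity) m
  rw [div_le_iff₀ (by positivity), div_pow, div_le_iff₀ (by positivity)] at h
  calc _ ≤ Real.exp ((1 + z) / 2) * m.factorial * 2 ^ m * Real.exp (-z) := by gcongr
    _ = 2 ^ m * m.factorial * Real.exp (1 / 2 + -(z / 2)) := by
        rw [show 1 / 2 + -(z / 2) = (1 + z) / 2 + -z by ring, Real.exp_add]; ring
    _ ≤ 2 ^ m * m.factorial * Real.exp (1 + -(z / 2)) := by gcongr; norm_num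
    _ = _ := by rw [Real.exp_add]; ring

theorem weighted_gaussian_sq_le (p : ℕ) {t r : ℝ} (ht : 0 ≤ t) (h0 : 0 ≤ r) (h1 : r ≤ 1) :
    (r ^ p * (1 + t * r ^ 2) ^ (p + 1) * Real.exp (-(t * r ^ 2) / 2)) ^ 2 ≤
      2 ^ (3 * p + 2) * (3 * p + 2).factorial * Real.exp 2 * ((1 + t) ^ p)⁻¹ *
        Real.exp (-((1 + t) / 2) * r ^ 2) := by
  set z := (1 + t) * r ^ 2 with hz
  have hz0 : 0 ≤ z := by positivity
  have hyz : t * r ^ 2 ≤ z := by rw [hz]; nlinarith [sq_nonneg r]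
  have hexp : Real.exp (-(t * r ^ 2)) ≤ Real.exp 1 * Real.exp (-z) := by
    rw [← Real.exp_add, hz]
    gcongr
    nlinarith
  have hrp : r ^ (2 * p) = ((1 + t) ^ p)⁻¹ * z ^ p := by
    rw [hz, mul_pow, ← pow_mul]; field_simp
  calc _ = r ^ (2 * p) * (1 + t * r ^ 2) ^ (2 * p + 2) * Real.exp (-(t * r ^ 2)) := by
        have : Real.exp (-(t * r ^ 2)) = Real.exp (-(t * r ^ 2) / 2) ^ 2 := by
          rw [← Real.exp_nat_mul]; congr 1; push_cast; ring
        rw [this]; ring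
    _ ≤ ((1 + t) ^ p)⁻¹ * (1 + z) ^ p * (1 + z) ^ (2 * p + 2) *
          (Real.exp 1 * Real.exp (-z)) := by
        rw [hrp]; gcongr; linarith
    _ = ((1 + t) ^ p)⁻¹ * Real.exp 1 * ((1 + z) ^ (3 * p + 2) * Real.exp (-z)) := by ring
    _ ≤ ((1 + t) ^ p)⁻¹ * Real.exp 1 *
          (2 ^ (3 * p + 2) * (3 * p + 2).factorial * Real.exp 1 * Real.exp (-(z / 2))) := by
        exact mul_le_mul_of_nonneg_left (one_add_pow_mul_exp_neg_le _ hz0) (by positivity)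
    _ = _ := by
        rw [show (2 : ℝ) = 1 + 1 by norm_num, Real.exp_add, hz]; ring_nf

theorem stmt9 (n : ℕ) (hn : 1 ≤ n) (p : ℕ) :
    ∃ C : ℝ, 0 < C ∧ ∀ t : ℝ, 0 < t →
      Real.sqrt (∫ ξ in Metric.closedBall (0 : Rn n) 1,
          |E1 n t ξ - ∑ k ∈ Finset.range (p + 1), e1 n k t ξ| ^ 2) ≤
        C * (1 + t) ^ (-(n : ℝ) / 4 - (p : ℝ) / 2) := by
  obtain ⟨M, hM0, hM⟩ := exists_abs_E1_sub_sum_e1_le n p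
  set K : ℝ := 2 ^ (3 * p + 2) * (3 * p + 2).factorial * Real.exp 2 with hK
  have hK0 : 0 < K := by positivity
  set D : ℝ := M ^ 2 * K * (2 * Real.pi) ^ ((n : ℝ) / 2) with hD
  have hD0 : 0 ≤ D := by positivity
  refine ⟨Real.sqrt D + 1, by positivity, fun t ht => ?_⟩
  have hs : 0 < 1 + t := by positivity
  have hb : 0 < (1 + t) / 2 := by positivity
  have hgauss : ∫ ξ : Rn n, Real.exp (-((1 + t) / 2) * ‖ξ‖ ^ 2) =
      (2 * Real.pi) ^ ((n : ℝ) / 2) * (1 + t) ^ (-(n : ℝ) / 2) := by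
    rw [GaussianFourier.integral_rexp_neg_mul_sq_norm hb, finrank_euclideanSpace_fin,
      show Real.pi / ((1 + t) / 2) = (2 * Real.pi) / (1 + t) by field_simp,
      Real.div_rpow (by positivity) hs.le, neg_div, Real.rpow_neg hs.le, div_eq_mul_inv]
  have hint : Integrable fun ξ : Rn n => Real.exp (-((1 + t) / 2) * ‖ξ‖ ^ 2) := by
    by_contra h
    rw [integral_undef h] at hgauss
    have : 0 < (2 * Real.pi) ^ ((n : ℝ) / 2) * (1 + t) ^ (-(n : ℝ) / 2) := by positivity
    linarith
  have hint' := hint.const_mul (M ^ 2 * K * ((1 + t) ^ p)⁻¹)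
  have hle : ∫ ξ in Metric.closedBall (0 : Rn n) 1,
      |E1 n t ξ - ∑ k ∈ Finset.range (p + 1), e1 n k t ξ| ^ 2 ≤
      D * (1 + t) ^ (-(n : ℝ) / 2 - p) := by
    calc _ ≤ ∫ ξ in Metric.closedBall (0 : Rn n) 1,
          M ^ 2 * K * ((1 + t) ^ p)⁻¹ * Real.exp (-((1 + t) / 2) * ‖ξ‖ ^ 2) := by
          refine integral_mono_of_nonneg (ae_of_all _ fun _ => by positivity)
            hint'.integrableOn ?_
          filter_upwards [ae_restrict_mem Metric.isClosed_closedBall.measurableSet] with ξ hξ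
          have hξ1 : ‖ξ‖ ≤ 1 := mem_closedBall_zero_iff.1 hξ
          calc _ ≤ (M * ‖ξ‖ ^ p * (1 + t * ‖ξ‖ ^ 2) ^ (p + 1) *
                Real.exp (-(t * ‖ξ‖ ^ 2) / 2)) ^ 2 :=
                pow_le_pow_left₀ (abs_nonneg _) (hM t ht.le ξ hξ1) 2
            _ = M ^ 2 * (‖ξ‖ ^ p * (1 + t * ‖ξ‖ ^ 2) ^ (p + 1) *
                Real.exp (-(t * ‖ξ‖ ^ 2) / 2)) ^ 2 := by ring
            _ ≤ _ := mul_le_mul_of_nonneg_left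
                (weighted_gaussian_sq_le p ht.le (norm_nonneg ξ) hξ1) (sq_nonneg M)
            _ = _ := by rw [hK]; ring
      _ ≤ ∫ ξ : Rn n, M ^ 2 * K * ((1 + t) ^ p)⁻¹ * Real.exp (-((1 + t) / 2) * ‖ξ‖ ^ 2) :=
          setIntegral_le_integral hint' (ae_of_all _ fun _ => by positivity)
      _ = D * (1 + t) ^ (-(n : ℝ) / 2 - p) := by
          rw [integral_const_mul, hgauss, Real.rpow_sub hs, Real.rpow_natCast, hD]
          ring
  calc _ ≤ Real.sqrt (D * (1 + t) ^ (-(n : ℝ) / 2 - p)) := Real.sqrt_le_sqrt hle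
    _ = Real.sqrt D * (1 + t) ^ (-(n : ℝ) / 4 - (p : ℝ) / 2) := by
        rw [Real.sqrt_mul hD0, Real.sqrt_eq_rpow ((1 + t) ^ _), ← Real.rpow_mul hs.le]
        congr 2
        ring
    _ ≤ _ := by gcongr; linarith
end
end

section
/- Let n ≥ 1 and γ ≥ 0. Then there exists a constant C > 0 such that for all f ∈ L^{1,γ}(ℝⁿ) and all ξ ∈ ℝⁿ: | f̂(ξ) − Σ_{k=0}^{⌊γ⌋} m[f]^k(ξ) | ≤ C |ξ|^γ ∫_{ℝⁿ} |x|^γ |f(x)| dx. -/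
open MeasureTheory Filter

noncomputable section

open Complex in
/-- The Taylor remainder of order `⌊γ⌋` of `e^{-is}` is `O(|s|^γ)` uniformly in real `s`. -/
theorem norm_exp_neg_I_mul_sub_taylor_le {γ : ℝ} (hγ : 0 ≤ γ) (s : ℝ) :
    ‖exp (-I * s) - ∑ k ∈ Finset.range (⌊γ⌋₊ + 1), (-I * s) ^ k / (k.factorial : ℂ)‖ ≤
      (⌊γ⌋₊ + 2) * |s| ^ γ := by
  have hn : ‖-I * (s : ℂ)‖ = |s| := by simp
  rcases le_or_gt |s| 1 with h | h
  · have h2 : ‖-I * (s : ℂ)‖ / ((⌊γ⌋₊ + 1).succ : ℕ) ≤ 1 / 2 := by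
      rw [hn]
      push_cast
      have : (0 : ℝ) ≤ ⌊γ⌋₊ := Nat.cast_nonneg _
      gcongr
      linarith
    refine (exp_bound' h2).trans ?_
    rw [hn]
    have hpow : |s| ^ (⌊γ⌋₊ + 1) ≤ |s| ^ γ := by
      rcases (abs_nonneg s).eq_or_lt with h0 | h0
      · rw [← h0, zero_pow (Nat.succ_ne_zero _)]
        positivity
      · rw [← Real.rpow_natCast]
        refine Real.rpow_le_rpow_of_exponent_ge h0 h ?_
        push_cast
        exact (Nat.lt_floor_add_one γ).le
    have hfac : (1 : ℝ) ≤ (⌊γ⌋₊ + 1).factorial := by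
      exact_mod_cast (Nat.factorial_pos _)
    calc |s| ^ (⌊γ⌋₊ + 1) / ((⌊γ⌋₊ + 1).factorial : ℝ) * 2
        ≤ |s| ^ (⌊γ⌋₊ + 1) * 2 := by
          gcongr
          exact div_le_self (by positivity) hfac
      _ ≤ |s| ^ γ * (⌊γ⌋₊ + 2) := by
          gcongr
          linarith [Nat.cast_nonneg (α := ℝ) ⌊γ⌋₊]
      _ = _ := mul_comm _ _
  · have hterm : ∀ k ∈ Finset.range (⌊γ⌋₊ + 1),
        ‖(-I * (s : ℂ)) ^ k / (k.factorial : ℂ)‖ ≤ |s| ^ γ := by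
      intro k hk
      rw [norm_div, norm_pow, hn, norm_natCast]
      refine (div_le_self (by positivity) (by exact_mod_cast Nat.factorial_pos k)).trans ?_
      rw [← Real.rpow_natCast]
      refine Real.rpow_le_rpow_of_exponent_le h.le ?_
      exact (Nat.le_floor_iff hγ).1 (Nat.lt_succ_iff.1 (Finset.mem_range.1 hk))
    have hexp : ‖exp (-I * (s : ℂ))‖ = 1 := by
      simpa [mul_comm] using norm_exp_ofReal_mul_I (-s)
    calc _ ≤ ‖exp (-I * (s : ℂ))‖ +
          ‖∑ k ∈ Finset.range (⌊γ⌋₊ + 1), (-I * (s : ℂ)) ^ k / (k.factorial : ℂ)‖ :=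
          norm_sub_le _ _
      _ ≤ |s| ^ γ + (⌊γ⌋₊ + 1 : ℕ) * |s| ^ γ := by
          gcongr
          · rw [hexp]
            exact Real.one_le_rpow h.le hγ
          · simpa using norm_sum_le_of_le _ hterm
      _ = _ := by
          push_cast
          ring

/-- The multinomial theorem, with multi-indices valued in `Fin (k + 1)`. -/
theorem sum_pow_div_factorial {n : ℕ} (k : ℕ) (y : Fin n → ℂ) :
    (∑ i, y i) ^ k / (k.factorial : ℂ) =
      ∑ α ∈ Finset.univ.filter (fun α : Fin n → Fin (k + 1) => ∑ i, (α i).val = k),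
        (∏ i, y i ^ (α i).val) / ∏ i, ((α i).val.factorial : ℂ) := by
  rw [Finset.sum_pow_eq_sum_piAntidiag, Finset.sum_div]
  symm
  refine Finset.sum_bij (fun α _ i => (α i).val) ?_ ?_ ?_ ?_
  · intro α hα
    simpa using hα
  · intro α _ β _ h
    ext i
    exact congrFun h i
  · intro b hb
    have hb' : ∑ i, b i = k := by simpa using hb
    have hlt : ∀ i, b i < k + 1 := fun i =>
      Nat.lt_succ_of_le (hb' ▸ Finset.single_le_sum (fun j _ => Nat.zero_le (b j))
        (Finset.mem_univ i))
    exact ⟨fun i => ⟨b i, hlt i⟩, by simpa using hb', rfl⟩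
  · intro α hα
    have hα' : ∑ i, (α i).val = k := by simpa using hα
    have hspec := Nat.multinomial_spec Finset.univ (fun i => (α i).val)
    rw [hα'] at hspec
    have hspec' : (∏ i, ((α i).val.factorial : ℂ)) *
        (Nat.multinomial Finset.univ (fun i => (α i).val) : ℂ) = (k.factorial : ℂ) := by
      exact_mod_cast hspec
    have h1 : (∏ i, ((α i).val.factorial : ℂ)) ≠ 0 :=
      Finset.prod_ne_zero_iff.2 fun i _ => by exact_mod_cast Nat.factorial_ne_zero _
    have h2 : (k.factorial : ℂ) ≠ 0 := by exact_mod_cast Nat.factorial_ne_zero k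
    rw [div_eq_div_iff h1 h2, ← hspec']
    ring

theorem abs_prod_coord_pow_le {n k : ℕ} (x : Rn n) (α : Fin n → ℕ) (hα : ∑ i, α i = k) :
    |∏ i, x i ^ α i| ≤ ‖x‖ ^ k := by
  rw [Finset.abs_prod, ← hα, ← Finset.prod_pow_eq_pow_sum]
  refine Finset.prod_le_prod (fun i _ => abs_nonneg _) fun i _ => ?_
  rw [abs_pow]
  gcongr
  exact PiLp.norm_apply_le x i

theorem MemL1w.integrable_monomial_mul {n k : ℕ} {γ : ℝ} {f : Rn n → ℝ} (hf : MemL1w n γ f)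
    (hk : (k : ℝ) ≤ γ) (α : Fin n → ℕ) (hα : ∑ i, α i = k) :
    Integrable (fun x : Rn n => (∏ i, x i ^ α i) * f x) := by
  refine hf.2.mono' (AEStronglyMeasurable.mul (by fun_prop) hf.1.aestronglyMeasurable) ?_
  refine Eventually.of_forall fun x => ?_
  rw [Real.norm_eq_abs, abs_mul]
  gcongr
  refine (abs_prod_coord_pow_le x α hα).trans ?_
  calc ‖x‖ ^ k ≤ (1 + ‖x‖) ^ k := by gcongr; linarith
    _ = (1 + ‖x‖) ^ (k : ℝ) := (Real.rpow_natCast _ _).symm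
    _ ≤ _ := Real.rpow_le_rpow_of_exponent_le (by linarith [norm_nonneg x]) hk

theorem MemL1w.integrable_norm_rpow_mul {n : ℕ} {γ : ℝ} {f : Rn n → ℝ} (hf : MemL1w n γ f)
    (hγ : 0 ≤ γ) : Integrable (fun x : Rn n => ‖x‖ ^ γ * |f x|) := by
  refine hf.2.mono' (AEStronglyMeasurable.mul (by fun_prop)
    hf.1.abs.aestronglyMeasurable) (Eventually.of_forall fun x => ?_)
  rw [Real.norm_of_nonneg (by positivity)]
  gcongr
  linarith

/-- The Taylor term of order `k` of `e^{-i x·ξ} f(x)`, expanded in monomials. -/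
theorem taylor_term_eq_sum {n : ℕ} (k : ℕ) (x ξ : Rn n) (c : ℝ) :
    (-Complex.I * ((∑ i, x i * ξ i : ℝ) : ℂ)) ^ k / (k.factorial : ℂ) * (c : ℂ) =
      ∑ α ∈ Finset.univ.filter (fun α : Fin n → Fin (k + 1) => ∑ i, (α i).val = k),
        ((-1 : ℂ) ^ k / ∏ i, ((α i).val.factorial : ℂ)) *
          (((∏ i, x i ^ (α i).val) * c : ℝ) : ℂ) *
          ∏ i, (Complex.I * (ξ i : ℂ)) ^ (α i).val := by
  have h : -Complex.I * ((∑ i, x i * ξ i : ℝ) : ℂ) =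
      -1 * ∑ i, (x i : ℂ) * (Complex.I * (ξ i : ℂ)) := by
    push_cast
    rw [Finset.mul_sum, Finset.mul_sum]
    exact Finset.sum_congr rfl fun i _ => by ring
  rw [h, mul_pow, mul_div_assoc, sum_pow_div_factorial, Finset.mul_sum, Finset.sum_mul]
  refine Finset.sum_congr rfl fun α _ => ?_
  simp_rw [mul_pow _ (Complex.I * _), Finset.prod_mul_distrib]
  push_cast
  ring

theorem MemL1w.integrable_taylor_term {n k : ℕ} {γ : ℝ} {f : Rn n → ℝ} (hf : MemL1w n γ f)
    (hk : (k : ℝ) ≤ γ) (ξ : Rn n) :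
    Integrable (fun x : Rn n =>
      (-Complex.I * ((∑ i, x i * ξ i : ℝ) : ℂ)) ^ k / (k.factorial : ℂ) * (f x : ℂ)) := by
  simp_rw [taylor_term_eq_sum]
  refine integrable_finsetSum _ fun α hα => ?_
  exact ((hf.integrable_monomial_mul hk _ (Finset.mem_filter.1 hα).2).ofReal.const_mul
    _).mul_const _

theorem MemL1w.mom_eq_integral {n k : ℕ} {γ : ℝ} {f : Rn n → ℝ} (hf : MemL1w n γ f)
    (hk : (k : ℝ) ≤ γ) (ξ : Rn n) :
    mom n f k ξ = ∫ x : Rn n,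
      (-Complex.I * ((∑ i, x i * ξ i : ℝ) : ℂ)) ^ k / (k.factorial : ℂ) * (f x : ℂ) := by
  simp_rw [taylor_term_eq_sum]
  rw [integral_finsetSum]
  · refine Finset.sum_congr rfl fun α _ => ?_
    rw [integral_mul_const, integral_const_mul, integral_complex_ofReal]
  · intro α hα
    exact ((hf.integrable_monomial_mul hk _ (Finset.mem_filter.1 hα).2).ofReal.const_mul
      _).mul_const _

theorem MemL1w.integrable_exp_mul {n : ℕ} {γ : ℝ} {f : Rn n → ℝ} (hf : MemL1w n γ f)
    (ξ : Rn n) : Integrable (fun x : Rn n =>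
      Complex.exp (-Complex.I * ((∑ i, x i * ξ i : ℝ) : ℂ)) * (f x : ℂ)) := by
  refine hf.1.ofReal.bdd_mul (c := 1) (by fun_prop) (Eventually.of_forall fun x => ?_)
  rw [neg_mul, ← mul_neg, mul_comm, ← Complex.ofReal_neg, Complex.norm_exp_ofReal_mul_I]

theorem abs_sum_mul_le_norm_mul_norm {n : ℕ} (x ξ : Rn n) :
    |∑ i, x i * ξ i| ≤ ‖x‖ * ‖ξ‖ := by
  have h : inner ℝ x ξ = ∑ i, x i * ξ i := by
    simp [PiLp.inner_apply, mul_comm]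
  rw [← h]
  exact abs_real_inner_le_norm x ξ

theorem stmt11 (n : ℕ) (hn : 1 ≤ n) (γ : ℝ) (hγ : 0 ≤ γ) :
    ∃ C : ℝ, 0 < C ∧ ∀ f : Rn n → ℝ, MemL1w n γ f → ∀ ξ : Rn n,
      ‖fourierHat n f ξ - ∑ k ∈ Finset.range (⌊γ⌋₊ + 1), mom n f k ξ‖ ≤
        C * ‖ξ‖ ^ γ * ∫ x : Rn n, ‖x‖ ^ γ * |f x| := by
  refine ⟨⌊γ⌋₊ + 2, by positivity, fun f hf ξ => ?_⟩
  have hle : ∀ k ∈ Finset.range (⌊γ⌋₊ + 1), (k : ℝ) ≤ γ := fun k hk =>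
    (Nat.le_floor_iff hγ).1 (Nat.lt_succ_iff.1 (Finset.mem_range.1 hk))
  rw [Finset.sum_congr rfl fun k hk => hf.mom_eq_integral (hle k hk) ξ,
    ← integral_finsetSum _ fun k hk => hf.integrable_taylor_term (hle k hk) ξ, fourierHat,
    ← integral_sub (hf.integrable_exp_mul ξ)
      (integrable_finsetSum _ fun k hk => hf.integrable_taylor_term (hle k hk) ξ),
    ← integral_const_mul]
  refine norm_integral_le_of_norm_le ((hf.integrable_norm_rpow_mul hγ).const_mul _)
    (Eventually.of_forall fun x => ?_)
  rw [← Finset.sum_mul, ← sub_mul, norm_mul, Complex.norm_real, Real.norm_eq_abs, ← mul_assoc]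
  gcongr
  refine (norm_exp_neg_I_mul_sub_taylor_le hγ _).trans ?_
  rw [mul_assoc, ← Real.mul_rpow (norm_nonneg ξ) (norm_nonneg x), mul_comm ‖ξ‖]
  gcongr
  exact abs_sum_mul_le_norm_mul_norm x ξ
end
end

section
/- Let n ≥ 1 and let γ satisfy: γ > 1/2 if n = 1, γ > 0 if n = 2, γ ≥ 0 if n ≥ 3. Then there exists T > 0 such that for all t ≥ T: ∫_{|ξ|≤1} |ξ|^{2γ} e^{−t|ξ|²} | sin(t|ξ|)/|ξ| |² dξ ≥ (ω_n/4) ( ∫_0^1 x^{2γ+n−3} e^{−x²} dx ) t^{−n/2−γ+1}, where ω_n = 2π^{n/2}/Γ(n/2) is the surface area of the unit sphere in ℝⁿ. -/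
open MeasureTheory Filter

noncomputable section

/-- Riemann–Lebesgue lemma for cosines. -/
theorem tendsto_integral_mul_cos_atTop (g : ℝ → ℝ) (hg : Integrable g) :
    Tendsto (fun s : ℝ => ∫ x, g x * Real.cos (2 * (s * x))) atTop (nhds 0) := by
  have h := (Real.tendsto_integral_exp_smul_cocompact (fun x => (g x : ℂ)))
  have h2 : Tendsto (fun s : ℝ => s / Real.pi) atTop (cocompact ℝ) :=
    (tendsto_id.atTop_div_const Real.pi_pos).mono_right atTop_le_cocompact
  have h3 := (Complex.continuous_re.tendsto 0).comp (h.comp h2)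
  refine h3.congr fun s => ?_
  have hint : Integrable (fun v : ℝ => Real.fourierChar (-(v * (s / Real.pi))) • (g v : ℂ)) := by
    refine (hg.ofReal (𝕜 := ℂ)).bdd_mul (c := 1) ?_ ?_
    · exact (Continuous.aestronglyMeasurable (by fun_prop))
    · exact ae_of_all _ fun x => (Circle.norm_coe _).le
  have h4 := integral_re hint
  simp only [Function.comp, RCLike.re_eq_complex_re] at h4 ⊢
  rw [← h4]
  refine integral_congr_ae (ae_of_all _ fun x => ?_)
  simp only [Circle.smul_def, Real.fourierChar_apply, smul_eq_mul, Complex.re_mul_ofReal]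
  rw [Complex.exp_ofReal_mul_I_re, mul_comm]
  congr 1
  rw [← Real.cos_neg]
  congr 1
  field_simp

theorem eventually_quarter_integral_le_integral_mul_sin_sq (g : ℝ → ℝ)
    (hg : IntervalIntegrable g volume 0 1) (hpos : 0 < ∫ x in (0 : ℝ)..1, g x) :
    ∀ᶠ s : ℝ in atTop,
      (∫ x in (0 : ℝ)..1, g x) / 4 ≤ ∫ x in (0 : ℝ)..1, g x * Real.sin (s * x) ^ 2 := by
  have hg' : IntegrableOn g (Set.Ioc 0 1) :=
    (intervalIntegrable_iff_integrableOn_Ioc_of_le zero_le_one).1 hg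
  have h := tendsto_integral_mul_cos_atTop _
    ((integrable_indicator_iff measurableSet_Ioc).2 hg')
  filter_upwards [h.eventually (gt_mem_nhds (half_pos hpos))] with s hs
  have h1 : (∫ x, (Set.Ioc (0 : ℝ) 1).indicator g x * Real.cos (2 * (s * x))) =
      ∫ x in (0 : ℝ)..1, g x * Real.cos (2 * (s * x)) := by
    rw [intervalIntegral.integral_of_le zero_le_one, ← integral_indicator measurableSet_Ioc]
    simp only [Set.indicator_mul_left]
  rw [h1] at hs
  have hc : IntervalIntegrable (fun x => g x * Real.cos (2 * (s * x))) volume 0 1 :=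
    hg.mul_continuousOn (by fun_prop)
  have h2 : (∫ x in (0 : ℝ)..1, g x * Real.sin (s * x) ^ 2) =
      (∫ x in (0 : ℝ)..1, g x) / 2 - (∫ x in (0 : ℝ)..1, g x * Real.cos (2 * (s * x))) / 2 := by
    rw [← intervalIntegral.integral_div, ← intervalIntegral.integral_div,
      ← intervalIntegral.integral_sub (hg.div_const 2) (hc.div_const 2)]
    congr 1 with x
    rw [Real.sin_sq, Real.cos_sq]
    ring
  linarith

theorem intervalIntegrable_rpow_mul_exp_neg_sq {β : ℝ} (hβ : -1 < β) (a b : ℝ) :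
    IntervalIntegrable (fun x : ℝ => x ^ β * Real.exp (-x ^ 2)) volume a b :=
  (intervalIntegral.intervalIntegrable_rpow' hβ).mul_continuousOn (by fun_prop)

theorem integral_rpow_mul_exp_mul_sin_sq_rescale (β : ℝ) {s : ℝ} (hs : 0 < s) :
    (∫ r in (0 : ℝ)..1, r ^ β * Real.exp (-(s ^ 2 * r ^ 2)) * Real.sin (s ^ 2 * r) ^ 2) =
      s ^ (-β - 1) *
        ∫ x in (0 : ℝ)..s, x ^ β * Real.exp (-x ^ 2) * Real.sin (s * x) ^ 2 := by
  have h := intervalIntegral.integral_comp_mul_left (a := 0) (b := 1)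
    (fun x => x ^ β * Real.exp (-x ^ 2) * Real.sin (s * x) ^ 2) hs.ne'
  rw [mul_zero, mul_one, smul_eq_mul] at h
  rw [Real.rpow_sub_one hs.ne', div_eq_mul_inv, mul_assoc, ← h,
    ← intervalIntegral.integral_const_mul]
  refine intervalIntegral.integral_congr fun r hr => ?_
  rw [Set.uIcc_of_le zero_le_one] at hr
  rw [Real.mul_rpow hs.le hr.1, mul_pow, show s * (s * r) = s ^ 2 * r by ring, Real.rpow_neg hs.le]
  have := (Real.rpow_pos_of_pos hs β).ne'
  field_simp

theorem natCast_mul_volume_real_unitBall {n : ℕ} (hn : 1 ≤ n) :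
    n * (volume : Measure (EuclideanSpace ℝ (Fin n))).real (Metric.ball 0 1) =
      2 * Real.pi ^ ((n : ℝ) / 2) / Real.Gamma ((n : ℝ) / 2) := by
  have : Nonempty (Fin n) := ⟨⟨0, hn⟩⟩
  have hn' : (0 : ℝ) < n := by exact_mod_cast hn
  rw [Measure.real, EuclideanSpace.volume_ball, Real.Gamma_add_one (by simp; positivity)]
  have := Real.Gamma_pos_of_pos (half_pos hn')
  have hpi : Real.sqrt Real.pi ^ n = Real.pi ^ ((n : ℝ) / 2) := by
    rw [Real.sqrt_eq_rpow, ← Real.rpow_natCast, ← Real.rpow_mul Real.pi_pos.le]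
    congr 1
    ring
  simp only [Fintype.card_fin, ENNReal.ofReal_one, one_pow, one_mul, hpi]
  rw [ENNReal.toReal_ofReal (by positivity)]
  field_simp

theorem setIntegral_closedBall_fun_norm {n : ℕ} (hn : 1 ≤ n) (f : ℝ → ℝ) :
    ∫ ξ in Metric.closedBall (0 : EuclideanSpace ℝ (Fin n)) 1, f ‖ξ‖ =
      2 * Real.pi ^ ((n : ℝ) / 2) / Real.Gamma ((n : ℝ) / 2) *
        ∫ r in (0 : ℝ)..1, r ^ (n - 1) * f r := by
  have : Nonempty (Fin n) := ⟨⟨0, hn⟩⟩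
  have h := integral_fun_norm_addHaar (volume : Measure (EuclideanSpace ℝ (Fin n)))
    ((Set.Iic (1 : ℝ)).indicator f)
  have h1 : (fun ξ : EuclideanSpace ℝ (Fin n) => (Set.Iic (1 : ℝ)).indicator f ‖ξ‖) =
      (Metric.closedBall 0 1).indicator fun ξ => f ‖ξ‖ := by
    ext ξ
    simp [Set.indicator]
  rw [h1, integral_indicator measurableSet_closedBall] at h
  rw [h, finrank_euclideanSpace_fin, nsmul_eq_mul, smul_eq_mul, ← mul_assoc,
    natCast_mul_volume_real_unitBall hn, intervalIntegral.integral_of_le zero_le_one]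
  congr 1
  rw [← Set.Ioi_inter_Iic, ← setIntegral_indicator measurableSet_Iic]
  simp only [smul_eq_mul, Set.indicator_mul_right]

theorem stmt13 (n : ℕ) (hn : 1 ≤ n) (γ : ℝ)
    (hγ1 : n = 1 → 1 / 2 < γ) (hγ2 : n = 2 → 0 < γ) (hγ3 : 3 ≤ n → 0 ≤ γ) :
    ∃ T : ℝ, 0 < T ∧ ∀ t : ℝ, T ≤ t →
      2 * Real.pi ^ ((n : ℝ) / 2) / Real.Gamma ((n : ℝ) / 2) / 4 *
          (∫ x in (0 : ℝ)..1, x ^ (2 * γ + (n : ℝ) - 3) * Real.exp (-x ^ 2)) *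
          t ^ (-(n : ℝ) / 2 - γ + 1) ≤
        ∫ ξ in Metric.closedBall (0 : Rn n) 1,
          ‖ξ‖ ^ (2 * γ) * Real.exp (-(t * ‖ξ‖ ^ 2)) * (Real.sin (t * ‖ξ‖) / ‖ξ‖) ^ 2 := by
  have hn' : (0 : ℝ) < n := by exact_mod_cast hn
  have hβ : -1 < 2 * γ + (n : ℝ) - 3 := by
    obtain rfl | rfl | h : n = 1 ∨ n = 2 ∨ 3 ≤ n := by omega
    · have := hγ1 rfl
      push_cast
      linarith
    · have := hγ2 rfl
      push_cast
      linarith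
    · have := hγ3 h
      have : (3 : ℝ) ≤ n := by exact_mod_cast h
      linarith
  set β := 2 * γ + (n : ℝ) - 3 with hβdef
  have hω : 0 < 2 * Real.pi ^ ((n : ℝ) / 2) / Real.Gamma ((n : ℝ) / 2) := by
    have := Real.Gamma_pos_of_pos (half_pos hn')
    have := Real.pi_pos
    positivity
  have hint := intervalIntegrable_rpow_mul_exp_neg_sq hβ
  have hpos : 0 < ∫ x in (0 : ℝ)..1, x ^ β * Real.exp (-x ^ 2) :=
    intervalIntegral.intervalIntegral_pos_of_pos_on (hint 0 1)
      (fun x hx => mul_pos (Real.rpow_pos_of_pos hx.1 _) (Real.exp_pos _)) one_pos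
  obtain ⟨S, hS⟩ := eventually_atTop.1
    (eventually_quarter_integral_le_integral_mul_sin_sq _ (hint 0 1) hpos)
  refine ⟨max 1 S ^ 2, by positivity, fun t ht => ?_⟩
  obtain ⟨s, hs, rfl⟩ : ∃ s, max 1 S ≤ s ∧ s ^ 2 = t :=
    ⟨Real.sqrt t, Real.le_sqrt_of_sq_le ht, Real.sq_sqrt ((sq_nonneg _).trans ht)⟩
  have hs1 : 1 ≤ s := (le_max_left _ _).trans hs
  have hs0 : 0 < s := one_pos.trans_le hs1
  have hquarter := hS s ((le_max_right _ _).trans hs)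
  rw [setIntegral_closedBall_fun_norm hn fun r =>
    r ^ (2 * γ) * Real.exp (-(s ^ 2 * r ^ 2)) * (Real.sin (s ^ 2 * r) / r) ^ 2]
  have hradial : (∫ r in (0 : ℝ)..1, r ^ (n - 1) *
        (r ^ (2 * γ) * Real.exp (-(s ^ 2 * r ^ 2)) * (Real.sin (s ^ 2 * r) / r) ^ 2)) =
      ∫ r in (0 : ℝ)..1, r ^ β * Real.exp (-(s ^ 2 * r ^ 2)) * Real.sin (s ^ 2 * r) ^ 2 := by
    rw [intervalIntegral.integral_of_le zero_le_one, intervalIntegral.integral_of_le zero_le_one]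
    refine setIntegral_congr_fun measurableSet_Ioc fun r hr => ?_
    have hr0 : 0 < r := hr.1
    have hexp : r ^ β = r ^ (n - 1) * r ^ (2 * γ) / r ^ 2 := by
      rw [← Real.rpow_natCast, ← Real.rpow_natCast, ← Real.rpow_add hr0, ← Real.rpow_sub hr0,
        Nat.cast_sub hn, hβdef]
      congr 1
      push_cast
      ring
    simp only [hexp]
    ring
  have hmono : (∫ x in (0 : ℝ)..1, x ^ β * Real.exp (-x ^ 2) * Real.sin (s * x) ^ 2) ≤
      ∫ x in (0 : ℝ)..s, x ^ β * Real.exp (-x ^ 2) * Real.sin (s * x) ^ 2 := by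
    refine intervalIntegral.integral_mono_interval le_rfl zero_le_one hs1 ?_
      ((hint 0 s).mul_continuousOn (by fun_prop))
    filter_upwards [ae_restrict_mem measurableSet_Ioc] with x hx
    have : 0 ≤ x ^ β := Real.rpow_nonneg hx.1.le _
    simp only [Pi.zero_apply]
    positivity
  have hpow : (s ^ 2) ^ (-(n : ℝ) / 2 - γ + 1) = s ^ (-β - 1) := by
    rw [← Real.rpow_natCast, ← Real.rpow_mul hs0.le]
    congr 1
    push_cast
    ring
  rw [hradial, integral_rpow_mul_exp_mul_sin_sq_rescale β hs0, hpow, div_mul_eq_mul_div,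
    mul_div_assoc, mul_assoc, mul_comm (_ / 4)]
  have := Real.rpow_pos_of_pos hs0 (-β - 1)
  gcongr
  exact hquarter.trans hmono
end
end

section
/- Let n ≥ 1 and let γ satisfy: γ > 1/2 if n = 1, γ > 0 if n = 2, γ ≥ 0 if n ≥ 3. Then there exists a constant C > 0 such that for all t > 0: ∫_{|ξ|≤1} |ξ|^{2γ} e^{−t|ξ|²} | sin(t|ξ|)/|ξ| |² dξ ≤ C (1+t)^{−n/2−γ+1}. -/
open MeasureTheory Filter

noncomputable section

/-- The weight `r ^ q * exp (-b * r ^ 2)`, multiplied by the radial density `r ^ (n - 1)`, is a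
single power of `r` times a Gaussian. -/
lemma radialDensity_smul_rpow_mul_exp {n : ℕ} (hn : 1 ≤ n) (q b : ℝ) {r : ℝ} (hr : 0 < r) :
    r ^ (n - 1) • (r ^ q * Real.exp (-b * r ^ (2 : ℝ))) =
      r ^ ((n : ℝ) - 1 + q) * Real.exp (-b * r ^ (2 : ℝ)) := by
  have h : r ^ (n - 1) = r ^ ((n : ℝ) - 1) := by
    rw [← Real.rpow_natCast, Nat.cast_sub hn, Nat.cast_one]
  rw [smul_eq_mul, ← mul_assoc, h, ← Real.rpow_add hr]

lemma integrable_norm_rpow_mul_exp_neg_mul_sq {n : ℕ} (hn : 1 ≤ n) {q b : ℝ}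
    (hq : -(n : ℝ) < q) (hb : 0 < b) :
    Integrable fun ξ : Rn n => ‖ξ‖ ^ q * Real.exp (-b * ‖ξ‖ ^ (2 : ℝ)) := by
  have : Nonempty (Fin n) := ⟨⟨0, hn⟩⟩
  rw [integrable_fun_norm_addHaar volume
    (f := fun r : ℝ => r ^ q * Real.exp (-b * r ^ (2 : ℝ))), finrank_euclideanSpace_fin]
  refine (integrableOn_rpow_mul_exp_neg_mul_rpow (p := 2) (s := (n : ℝ) - 1 + q) (b := b)
    (by linarith) (by norm_num) hb).congr_fun (fun r hr => ?_) measurableSet_Ioi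
  exact (radialDensity_smul_rpow_mul_exp hn q b hr).symm

lemma integral_norm_rpow_mul_exp_neg_mul_sq {n : ℕ} (hn : 1 ≤ n) {q b : ℝ}
    (hq : -(n : ℝ) < q) (hb : 0 < b) :
    ∫ ξ : Rn n, ‖ξ‖ ^ q * Real.exp (-b * ‖ξ‖ ^ (2 : ℝ)) =
      n * volume.real (Metric.ball (0 : Rn n) 1) *
        (b ^ (-((n : ℝ) + q) / 2) * (1 / 2) * Real.Gamma (((n : ℝ) + q) / 2)) := by
  have : Nonempty (Fin n) := ⟨⟨0, hn⟩⟩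
  rw [integral_fun_norm_addHaar volume
    (fun r : ℝ => r ^ q * Real.exp (-b * r ^ (2 : ℝ))), finrank_euclideanSpace_fin,
    setIntegral_congr_fun measurableSet_Ioi
      (fun r hr => radialDensity_smul_rpow_mul_exp hn q b hr),
    integral_rpow_mul_exp_neg_mul_rpow (by norm_num) (by linarith) hb,
    show (n : ℝ) - 1 + q + 1 = n + q by ring, nsmul_eq_mul, smul_eq_mul, ← mul_assoc (n : ℝ)]

lemma rpow_mul_exp_mul_sin_div_sq_le (γ t : ℝ) {r : ℝ} (hr : 0 ≤ r) (hr1 : r ≤ 1) :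
    r ^ (2 * γ) * Real.exp (-(t * r ^ 2)) * (Real.sin (t * r) / r) ^ 2 ≤
      Real.exp 1 * (r ^ (2 * γ - 2) * Real.exp (-(1 + t) * r ^ (2 : ℝ))) := by
  rcases hr.eq_or_lt with rfl | hr0
  · simp only [div_zero, ne_eq, OfNat.ofNat_ne_zero, not_false_eq_true, zero_pow, mul_zero]
    positivity
  have hexp : Real.exp (-(t * r ^ 2)) ≤ Real.exp 1 * Real.exp (-(1 + t) * r ^ (2 : ℝ)) := by
    rw [← Real.exp_add, Real.exp_le_exp, Real.rpow_two]
    nlinarith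
  have hpow : r ^ (2 * γ - 2) = r ^ (2 * γ) / r ^ 2 := by
    rw [Real.rpow_sub hr0, Real.rpow_two]
  calc r ^ (2 * γ) * Real.exp (-(t * r ^ 2)) * (Real.sin (t * r) / r) ^ 2
      = r ^ (2 * γ) / r ^ 2 * (Real.exp (-(t * r ^ 2)) * Real.sin (t * r) ^ 2) := by
        rw [div_pow]; ring
    _ ≤ r ^ (2 * γ) / r ^ 2 * (Real.exp 1 * Real.exp (-(1 + t) * r ^ (2 : ℝ)) * 1) := by
        gcongr
        exact Real.sin_sq_le_one _
    _ = _ := by rw [hpow]; ring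

theorem stmt15 (n : ℕ) (hn : 1 ≤ n) (γ : ℝ)
    (hγ1 : n = 1 → 1 / 2 < γ) (hγ2 : n = 2 → 0 < γ) (hγ3 : 3 ≤ n → 0 ≤ γ) :
    ∃ C : ℝ, 0 < C ∧ ∀ t : ℝ, 0 < t →
      (∫ ξ in Metric.closedBall (0 : Rn n) 1,
          ‖ξ‖ ^ (2 * γ) * Real.exp (-(t * ‖ξ‖ ^ 2)) * (Real.sin (t * ‖ξ‖) / ‖ξ‖) ^ 2) ≤
        C * (1 + t) ^ (-(n : ℝ) / 2 - γ + 1) := by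
  have hq : -(n : ℝ) < 2 * γ - 2 := by
    obtain rfl | rfl | h3 : n = 1 ∨ n = 2 ∨ 3 ≤ n := by omega
    · have := hγ1 rfl
      norm_num
      linarith
    · have := hγ2 rfl
      norm_num
      linarith
    · have := hγ3 h3
      have : (3 : ℝ) ≤ n := by exact_mod_cast h3
      linarith
  have hΓ : 0 < Real.Gamma (((n : ℝ) + (2 * γ - 2)) / 2) := Real.Gamma_pos_of_pos (by linarith)
  have hvol : 0 < volume.real (Metric.ball (0 : Rn n) 1) :=
    ENNReal.toReal_pos (Metric.measure_ball_pos _ _ one_pos).ne' measure_ball_lt_top.ne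
  have hn0 : (0 : ℝ) < n := by exact_mod_cast hn
  refine ⟨Real.exp 1 * (n * volume.real (Metric.ball (0 : Rn n) 1) *
    (1 / 2 * Real.Gamma (((n : ℝ) + (2 * γ - 2)) / 2))), by positivity, fun t ht => ?_⟩
  have hint := (integrable_norm_rpow_mul_exp_neg_mul_sq hn hq
    (show 0 < 1 + t by linarith)).const_mul (Real.exp 1)
  calc _ ≤ ∫ ξ in Metric.closedBall (0 : Rn n) 1,
        Real.exp 1 * (‖ξ‖ ^ (2 * γ - 2) * Real.exp (-(1 + t) * ‖ξ‖ ^ (2 : ℝ))) := by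
        refine integral_mono_of_nonneg (.of_forall fun ξ => by positivity) hint.integrableOn ?_
        filter_upwards [ae_restrict_mem Metric.isClosed_closedBall.measurableSet] with ξ hξ
        exact rpow_mul_exp_mul_sin_div_sq_le γ t (norm_nonneg ξ) (mem_closedBall_zero_iff.1 hξ)
    _ ≤ ∫ ξ : Rn n, Real.exp 1 * (‖ξ‖ ^ (2 * γ - 2) * Real.exp (-(1 + t) * ‖ξ‖ ^ (2 : ℝ))) :=
        setIntegral_le_integral hint (.of_forall fun ξ => by positivity)
    _ = _ := by
        rw [integral_const_mul, integral_norm_rpow_mul_exp_neg_mul_sq hn hq (by linarith),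
          show -((n : ℝ) + (2 * γ - 2)) / 2 = -(n : ℝ) / 2 - γ + 1 by ring]
        ring
end
end

section
/- There exist constants 0 < C₁ ≤ C₂ < ∞ and T > 0 such that for all t ≥ T: C₁ t ≤ ∫_{−∞}^{∞} e^{−t ξ²} | sin(t|ξ|)/|ξ| |² dξ ≤ C₂ t. -/
open MeasureTheory Filter

noncomputable section

lemma exp_mul_sin_sq_div_sq_le {t : ℝ} (ht : 0 ≤ t) (ξ : ℝ) :
    Real.exp (-(t * ξ ^ 2)) * (Real.sin (t * |ξ|)) ^ 2 / ξ ^ 2 ≤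
      2 * t ^ 2 * (1 + (t * ξ) ^ 2)⁻¹ := by
  rcases eq_or_ne ξ 0 with rfl | hξ
  · simp only [ne_eq, OfNat.ofNat_ne_zero, not_false_eq_true, zero_pow, div_zero]
    positivity
  have hexp : Real.exp (-(t * ξ ^ 2)) ≤ 1 := Real.exp_le_one_iff.2 (by
    have : 0 ≤ t * ξ ^ 2 := by positivity
    linarith)
  have hsin : Real.sin (t * |ξ|) ^ 2 ≤ (t * ξ) ^ 2 := by
    have h := sq_le_sq.2 (Real.abs_sin_le_abs (x := t * |ξ|))
    rwa [mul_pow, sq_abs, ← mul_pow] at h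
  have hsin_one := Real.sin_sq_le_one (t * |ξ|)
  have hprod := mul_le_mul_of_nonneg_right hexp (sq_nonneg (Real.sin (t * |ξ|)))
  have hξ' : 0 < ξ ^ 2 := by positivity
  rw [← div_eq_mul_inv, div_le_div_iff₀ hξ' (by positivity)]
  have hprod' := mul_le_mul_of_nonneg_right hprod (by positivity : 0 ≤ 1 + (t * ξ) ^ 2)
  nlinarith [mul_le_mul_of_nonneg_right hsin_one (sq_nonneg (t * ξ))]

lemma le_exp_mul_sin_sq_div_sq {t ξ : ℝ} (ht : 1 ≤ t) (hξ : ξ ∈ Set.Ioc 0 t⁻¹) :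
    Real.exp (-1) * (2 / Real.pi) ^ 2 * t ^ 2 ≤
      Real.exp (-(t * ξ ^ 2)) * (Real.sin (t * |ξ|)) ^ 2 / ξ ^ 2 := by
  obtain ⟨hpos, hle⟩ := hξ
  have ht0 : 0 < t := by linarith
  have htξ : t * ξ ≤ 1 := by
    simpa [ht0.ne'] using mul_le_mul_of_nonneg_left hle ht0.le
  have hξ1 : ξ ≤ 1 := hle.trans (inv_le_one_of_one_le₀ ht)
  have hsin : 2 / Real.pi * (t * ξ) ≤ Real.sin (t * ξ) :=
    Real.mul_le_sin (by positivity) (by linarith [Real.pi_gt_three])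
  have hexp : Real.exp (-1) ≤ Real.exp (-(t * ξ ^ 2)) := Real.exp_le_exp.2 (by nlinarith)
  rw [abs_of_pos hpos, le_div_iff₀ (by positivity)]
  calc Real.exp (-1) * (2 / Real.pi) ^ 2 * t ^ 2 * ξ ^ 2
      = Real.exp (-1) * (2 / Real.pi * (t * ξ)) ^ 2 := by ring
    _ ≤ _ := by gcongr

lemma integrable_inv_one_add_mul_sq {t : ℝ} (ht : t ≠ 0) :
    Integrable fun ξ : ℝ => 2 * t ^ 2 * (1 + (t * ξ) ^ 2)⁻¹ :=
  (integrable_inv_one_add_sq.comp_mul_left' ht).const_mul _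

lemma integral_inv_one_add_mul_sq {t : ℝ} (ht : 0 < t) :
    ∫ ξ : ℝ, 2 * t ^ 2 * (1 + (t * ξ) ^ 2)⁻¹ = 2 * Real.pi * t := by
  rw [integral_const_mul, Measure.integral_comp_mul_left (fun x : ℝ => (1 + x ^ 2)⁻¹),
    integral_univ_inv_one_add_sq, abs_of_pos (inv_pos.2 ht), smul_eq_mul]
  field_simp

lemma integrable_exp_mul_sin_sq_div_sq {t : ℝ} (ht : 0 < t) :
    Integrable fun ξ : ℝ => Real.exp (-(t * ξ ^ 2)) * (Real.sin (t * |ξ|)) ^ 2 / ξ ^ 2 := by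
  refine (integrable_inv_one_add_mul_sq ht.ne').mono'
    (Measurable.aestronglyMeasurable (by fun_prop)) (.of_forall fun ξ => ?_)
  rw [Real.norm_of_nonneg (by positivity)]
  exact exp_mul_sin_sq_div_sq_le ht.le ξ

theorem stmt17 :
    ∃ C₁ C₂ : ℝ, 0 < C₁ ∧ C₁ ≤ C₂ ∧ ∃ T : ℝ, 0 < T ∧ ∀ t : ℝ, T ≤ t →
      C₁ * t ≤ (∫ ξ : ℝ, Real.exp (-(t * ξ ^ 2)) * (Real.sin (t * |ξ|)) ^ 2 / ξ ^ 2) ∧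
        (∫ ξ : ℝ, Real.exp (-(t * ξ ^ 2)) * (Real.sin (t * |ξ|)) ^ 2 / ξ ^ 2) ≤ C₂ * t := by
  have bounds : ∀ t : ℝ, 1 ≤ t → Real.exp (-1) * (2 / Real.pi) ^ 2 * t ≤
        (∫ ξ : ℝ, Real.exp (-(t * ξ ^ 2)) * (Real.sin (t * |ξ|)) ^ 2 / ξ ^ 2) ∧
      (∫ ξ : ℝ, Real.exp (-(t * ξ ^ 2)) * (Real.sin (t * |ξ|)) ^ 2 / ξ ^ 2) ≤
        2 * Real.pi * t := by
    intro t ht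
    have ht0 : 0 < t := by linarith
    have hint := integrable_exp_mul_sin_sq_div_sq ht0
    constructor
    · calc Real.exp (-1) * (2 / Real.pi) ^ 2 * t
          = ∫ _ in Set.Ioc 0 t⁻¹, Real.exp (-1) * (2 / Real.pi) ^ 2 * t ^ 2 := by
            rw [setIntegral_const, Real.volume_real_Ioc_of_le (by positivity), smul_eq_mul]
            field_simp
            ring
        _ ≤ ∫ ξ in Set.Ioc 0 t⁻¹,
              Real.exp (-(t * ξ ^ 2)) * (Real.sin (t * |ξ|)) ^ 2 / ξ ^ 2 :=
            setIntegral_mono_on (integrableOn_const (by simp)) hint.integrableOn measurableSet_Ioc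
              fun ξ hξ => le_exp_mul_sin_sq_div_sq ht hξ
        _ ≤ _ := setIntegral_le_integral hint (.of_forall fun ξ => by positivity)
    · rw [← integral_inv_one_add_mul_sq ht0]
      exact integral_mono hint (integrable_inv_one_add_mul_sq ht0.ne')
        (exp_mul_sin_sq_div_sq_le ht0.le)
  refine ⟨_, _, by positivity, ?_, 1, one_pos, bounds⟩
  simpa using (bounds 1 le_rfl).1.trans (bounds 1 le_rfl).2
end
end

section
/- There exist constants 0 < C₁ ≤ C₂ < ∞ and T > 1 such that for all t ≥ T: C₁ log t ≤ ∫_{ℝ²} e^{−t|ξ|²} | sin(t|ξ|)/|ξ| |² dξ ≤ C₂ log t. -/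
open MeasureTheory Filter

noncomputable section

open Set

/-- The radial profile of the integrand, including the Jacobian of polar coordinates. -/
def radialProfile (t r : ℝ) : ℝ := Real.exp (-(t * r ^ 2)) * (Real.sin (t * r) ^ 2 / r)

theorem measurable_radialProfile (t : ℝ) : Measurable (radialProfile t) := by
  unfold radialProfile
  fun_prop

theorem radialProfile_nonneg {t r : ℝ} (hr : 0 < r) : 0 ≤ radialProfile t r := by
  unfold radialProfile
  positivity

theorem radialProfile_le_inv {t r : ℝ} (ht : 0 < t) (hr : 0 < r) :
    radialProfile t r ≤ r⁻¹ := by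
  unfold radialProfile
  have h1 : Real.exp (-(t * r ^ 2)) ≤ 1 := Real.exp_le_one_iff.2 (neg_nonpos.2 (by positivity))
  have h2 : Real.sin (t * r) ^ 2 / r ≤ r⁻¹ := by
    rw [div_eq_mul_inv]
    exact mul_le_of_le_one_left (by positivity) (Real.sin_sq_le_one _)
  exact (mul_le_of_le_one_left (by positivity) h1).trans h2

theorem radialProfile_le {t r : ℝ} (ht : 0 < t) (hr : 0 < r) : radialProfile t r ≤ t := by
  unfold radialProfile
  have h1 : Real.exp (-(t * r ^ 2)) ≤ 1 :=
    Real.exp_le_one_iff.2 (neg_nonpos.2 (by positivity))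
  have h2 : Real.sin (t * r) ^ 2 / r ≤ t := by
    rw [div_le_iff₀ hr, ← sq_abs]
    have h3 : |Real.sin (t * r)| ≤ t * r := by
      simpa [abs_of_pos (mul_pos ht hr)] using Real.abs_sin_le_abs (x := t * r)
    nlinarith [abs_nonneg (Real.sin (t * r)), Real.abs_sin_le_one (t * r)]
  exact (mul_le_of_le_one_left (by positivity) h1).trans h2

theorem radialProfile_le_exp {t r : ℝ} (ht : 1 ≤ t) (hr : 1 ≤ r) :
    radialProfile t r ≤ Real.exp (-r) := by
  unfold radialProfile
  have h1 : Real.exp (-(t * r ^ 2)) ≤ Real.exp (-r) := by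
    apply Real.exp_le_exp.2
    nlinarith [mul_le_mul ht hr zero_le_one (by linarith)]
  have h2 : Real.sin (t * r) ^ 2 / r ≤ 1 := by
    rw [div_le_one (by linarith)]
    exact (Real.sin_sq_le_one _).trans hr
  exact (mul_le_of_le_one_right (Real.exp_pos _).le h2).trans h1

theorem integrableOn_radialProfile_Ioc {t a b : ℝ} (ht : 0 < t) (ha : 0 ≤ a) :
    IntegrableOn (radialProfile t) (Ioc a b) := by
  refine Integrable.mono' (g := fun _ => t) (integrableOn_const (by simp))
    (measurable_radialProfile t).aestronglyMeasurable ?_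
  filter_upwards [ae_restrict_mem measurableSet_Ioc] with r hr
  have hr0 : 0 < r := ha.trans_lt hr.1
  rw [Real.norm_of_nonneg (radialProfile_nonneg hr0)]
  exact radialProfile_le ht hr0

theorem integrableOn_radialProfile_Ioi_one {t : ℝ} (ht : 1 ≤ t) :
    IntegrableOn (radialProfile t) (Ioi 1) := by
  refine Integrable.mono' (integrableOn_exp_neg_Ioi 1)
    (measurable_radialProfile t).aestronglyMeasurable ?_
  filter_upwards [ae_restrict_mem measurableSet_Ioi] with r hr
  rw [Real.norm_of_nonneg (radialProfile_nonneg (zero_lt_one.trans hr))]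
  exact radialProfile_le_exp ht (le_of_lt hr)

theorem integrableOn_radialProfile {t : ℝ} (ht : 1 ≤ t) :
    IntegrableOn (radialProfile t) (Ioi 0) := by
  rw [← Ioc_union_Ioi_eq_Ioi zero_le_one]
  exact (integrableOn_radialProfile_Ioc (by linarith) le_rfl).union
    (integrableOn_radialProfile_Ioi_one ht)

theorem setIntegral_radialProfile_le {t : ℝ} (ht : 1 ≤ t) :
    ∫ r in Ioi 0, radialProfile t r ≤ 2 + Real.log t := by
  have ht0 : 0 < t := by linarith
  have hinv : t⁻¹ ≤ 1 := inv_le_one_of_one_le₀ ht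
  have hinv0 : 0 < t⁻¹ := by positivity
  have hsmall : ∫ r in Ioc 0 t⁻¹, radialProfile t r ≤ 1 := by
    calc ∫ r in Ioc 0 t⁻¹, radialProfile t r ≤ ∫ _r in Ioc 0 t⁻¹, t :=
          setIntegral_mono_on (integrableOn_radialProfile_Ioc ht0 le_rfl)
            (integrableOn_const (by simp)) measurableSet_Ioc
            fun r hr => radialProfile_le ht0 hr.1
      _ = 1 := by simp [hinv0.le, ht0.ne']
  have hmid : ∫ r in Ioc t⁻¹ 1, radialProfile t r ≤ Real.log t := by
    calc ∫ r in Ioc t⁻¹ 1, radialProfile t r ≤ ∫ r in Ioc t⁻¹ 1, r⁻¹ := by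
          refine setIntegral_mono_on (integrableOn_radialProfile_Ioc ht0 hinv0.le) ?_
            measurableSet_Ioc fun r hr => radialProfile_le_inv ht0 (hinv0.trans hr.1)
          rw [← intervalIntegrable_iff_integrableOn_Ioc_of_le hinv]
          exact intervalIntegral.intervalIntegrable_inv
            (fun r hr => by
              rw [uIcc_of_le hinv] at hr
              exact (hinv0.trans_le hr.1).ne') continuousOn_id
      _ = Real.log t := by
          rw [← intervalIntegral.integral_of_le hinv, integral_inv_of_pos hinv0 one_pos]
          simp
  have hlarge : ∫ r in Ioi 1, radialProfile t r ≤ 1 := by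
    calc ∫ r in Ioi 1, radialProfile t r ≤ ∫ r in Ioi (1 : ℝ), Real.exp (-r) :=
          setIntegral_mono_on (integrableOn_radialProfile_Ioi_one ht)
            (integrableOn_exp_neg_Ioi 1) measurableSet_Ioi
            fun r hr => radialProfile_le_exp ht (le_of_lt hr)
      _ ≤ 1 := by
          rw [integral_exp_neg_Ioi]
          exact Real.exp_le_one_iff.2 (by norm_num)
  rw [← Ioc_union_Ioi_eq_Ioi zero_le_one, setIntegral_union (Ioc_disjoint_Ioi le_rfl)
    measurableSet_Ioi (integrableOn_radialProfile_Ioc ht0 le_rfl)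
    (integrableOn_radialProfile_Ioi_one ht), ← Ioc_union_Ioc_eq_Ioc hinv0.le hinv,
    setIntegral_union (Ioc_disjoint_Ioc_of_le le_rfl) measurableSet_Ioc
    (integrableOn_radialProfile_Ioc ht0 le_rfl) (integrableOn_radialProfile_Ioc ht0 hinv0.le)]
  linarith

/-- A primitive of a lower bound of `sin (t * r) ^ 2 / r`. -/
theorem exists_hasDerivAt_le_sin_sq_div {t r : ℝ} (ht : 0 < t) (hr : 0 < r) :
    ∃ d ≤ Real.sin (t * r) ^ 2 / r, HasDerivAt
      (fun s => Real.log s / 2 - Real.sin (2 * (t * s)) / (4 * t * s) + (4 * t * s)⁻¹) d r := by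
  have h4 : HasDerivAt (fun s => 4 * t * s) (4 * t) r := by
    simpa using (hasDerivAt_id r).const_mul (4 * t)
  have hne : 4 * t * r ≠ 0 := by positivity
  have hsin : HasDerivAt (fun s => Real.sin (2 * (t * s)))
      (Real.cos (2 * (t * r)) * (2 * t)) r := by
    refine HasDerivAt.sin ?_
    simpa using ((hasDerivAt_id r).const_mul t).const_mul 2
  refine ⟨_, ?_, (((Real.hasDerivAt_log hr.ne').div_const 2).sub
    (hsin.fun_div h4 hne)).add (h4.fun_inv hne)⟩
  have hcos : Real.cos (2 * (t * r)) = 1 - 2 * Real.sin (t * r) ^ 2 := by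
    rw [Real.cos_two_mul, Real.cos_sq']
    ring
  rw [hcos, ← sub_nonneg]
  have key : 0 ≤ (1 - Real.sin (2 * (t * r))) / (4 * t * r ^ 2) :=
    div_nonneg (by linarith [Real.sin_le_one (2 * (t * r))]) (by positivity)
  convert key using 1
  field_simp
  ring

theorem le_setIntegral_radialProfile {t : ℝ} (ht : 1 ≤ t) :
    Real.exp (-1) * (Real.log t / 4 - 1 / 2) ≤ ∫ r in Ioi 0, radialProfile t r := by
  have ht0 : 0 < t := by linarith
  have hs0 : 0 < √t := Real.sqrt_pos.2 ht0
  have hs1 : 1 ≤ √t := Real.one_le_sqrt.2 ht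
  have hsq : √t * √t = t := Real.mul_self_sqrt ht0.le
  have ha : 0 < t⁻¹ := by positivity
  have hab : t⁻¹ ≤ (√t)⁻¹ := by
    apply inv_anti₀ hs0
    nlinarith
  set F : ℝ → ℝ := fun s =>
    Real.log s / 2 - Real.sin (2 * (t * s)) / (4 * t * s) + (4 * t * s)⁻¹ with hF
  have hderiv : ∀ r ∈ Icc t⁻¹ (√t)⁻¹, HasDerivAt F (deriv F r) r := fun r hr => by
    obtain ⟨d, -, hd⟩ := exists_hasDerivAt_le_sin_sq_div ht0 (ha.trans_le hr.1)
    exact hd.differentiableAt.hasDerivAt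
  have hint := intervalIntegral.sub_le_integral_of_hasDeriv_right_of_le
    (g := fun r => Real.exp (-1) * F r) (φ := radialProfile t) hab
    (fun r hr => ((hderiv r hr).const_mul _).continuousAt.continuousWithinAt)
    (fun r hr => ((hderiv r (Ioo_subset_Icc_self hr)).const_mul _).hasDerivWithinAt)
    ((integrableOn_Icc_iff_integrableOn_Ioc).2 (integrableOn_radialProfile_Ioc ht0 ha.le))
    (fun r hr => by
      have hr0 : 0 < r := ha.trans hr.1
      obtain ⟨d, hd, hd'⟩ := exists_hasDerivAt_le_sin_sq_div ht0 hr0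
      rw [hd'.deriv]
      have hexp : Real.exp (-1) ≤ Real.exp (-(t * r ^ 2)) := by
        apply Real.exp_le_exp.2
        have h1 : √t * r ≤ 1 := by
          have := mul_le_mul_of_nonneg_left hr.2.le hs0.le
          rwa [mul_inv_cancel₀ hs0.ne'] at this
        have h2 : t * r ^ 2 = (√t * r) ^ 2 := by rw [mul_pow, sq √t, hsq]
        rw [h2, neg_le_neg_iff]
        exact pow_le_one₀ (by positivity) h1
      calc Real.exp (-1) * d ≤ Real.exp (-1) * (Real.sin (t * r) ^ 2 / r) := by gcongr
        _ ≤ radialProfile t r := by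
          unfold radialProfile
          gcongr)
  rw [intervalIntegral.integral_of_le hab] at hint
  have hmono : ∫ r in Ioc t⁻¹ (√t)⁻¹, radialProfile t r ≤ ∫ r in Ioi 0, radialProfile t r := by
    refine setIntegral_mono_set (integrableOn_radialProfile ht) ?_ ?_
    · filter_upwards [ae_restrict_mem measurableSet_Ioi] with r hr
      exact radialProfile_nonneg hr
    · exact LE.le.eventuallyLE fun r hr => ha.trans hr.1
  have hFb : -Real.log t / 4 ≤ F (√t)⁻¹ := by
    have hs : 0 < 4 * t * (√t)⁻¹ := by positivity
    have h1 : Real.sin (2 * (t * (√t)⁻¹)) / (4 * t * (√t)⁻¹) ≤ (4 * t * (√t)⁻¹)⁻¹ := by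
      rw [div_eq_mul_inv]
      exact mul_le_of_le_one_left (by positivity) (Real.sin_le_one _)
    have h2 : Real.log (√t)⁻¹ = -(Real.log t / 2) := by
      rw [Real.log_inv, Real.log_sqrt ht0.le]
    simp only [hF, h2]
    linarith
  have hFa : F t⁻¹ ≤ -Real.log t / 2 + 1 / 2 := by
    have h1 : 4 * t * t⁻¹ = 4 := by field_simp
    simp only [hF, h1, Real.log_inv]
    linarith [Real.neg_one_le_sin (2 * (t * t⁻¹))]
  refine le_trans ?_ (hint.trans hmono)
  rw [← mul_sub]
  exact mul_le_mul_of_nonneg_left (by linarith) (Real.exp_pos _).le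

theorem integral_eq_radialProfile (t : ℝ) :
    ∫ ξ : Rn 2, Real.exp (-(t * ‖ξ‖ ^ 2)) * (Real.sin (t * ‖ξ‖) / ‖ξ‖) ^ 2 =
      2 * volume.real (Metric.ball (0 : Rn 2) 1) * ∫ r in Ioi 0, radialProfile t r := by
  rw [integral_fun_norm_addHaar volume
    (fun r : ℝ => Real.exp (-(t * r ^ 2)) * (Real.sin (t * r) / r) ^ 2)]
  have h : ∫ r in Ioi (0 : ℝ), r ^ (Module.finrank ℝ (Rn 2) - 1) •
      (Real.exp (-(t * r ^ 2)) * (Real.sin (t * r) / r) ^ 2) =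
      ∫ r in Ioi 0, radialProfile t r := by
    refine setIntegral_congr_fun measurableSet_Ioi fun r hr => ?_
    have hr0 : r ≠ 0 := (mem_Ioi.1 hr).ne'
    simp only [finrank_euclideanSpace_fin, smul_eq_mul, radialProfile,
      Nat.add_one_sub_one, pow_one]
    field_simp
  rw [h]
  simp [mul_assoc]

theorem stmt18 :
    ∃ C₁ C₂ : ℝ, 0 < C₁ ∧ C₁ ≤ C₂ ∧ ∃ T : ℝ, 1 < T ∧ ∀ t : ℝ, T ≤ t →
      C₁ * Real.log t ≤
          (∫ ξ : Rn 2, Real.exp (-(t * ‖ξ‖ ^ 2)) * (Real.sin (t * ‖ξ‖) / ‖ξ‖) ^ 2) ∧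
        (∫ ξ : Rn 2, Real.exp (-(t * ‖ξ‖ ^ 2)) * (Real.sin (t * ‖ξ‖) / ‖ξ‖) ^ 2) ≤
          C₂ * Real.log t := by
  set c : ℝ := 2 * volume.real (Metric.ball (0 : Rn 2) 1) with hc
  have hc0 : 0 < c := mul_pos two_pos
    (ENNReal.toReal_pos (Metric.measure_ball_pos _ _ one_pos).ne' measure_ball_lt_top.ne)
  have he : Real.exp (-1) ≤ 1 := Real.exp_le_one_iff.2 (by norm_num)
  refine ⟨c * (Real.exp (-1) / 8), c * 2, by positivity, by gcongr; linarith,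
    Real.exp 4, Real.one_lt_exp_iff.2 (by norm_num), fun t ht => ?_⟩
  have ht1 : 1 ≤ t := (Real.one_le_exp (by norm_num)).trans ht
  have hlog : 4 ≤ Real.log t := (Real.le_log_iff_exp_le (by linarith)).2 ht
  rw [integral_eq_radialProfile, ← hc, mul_assoc c, mul_assoc c]
  constructor
  · refine mul_le_mul_of_nonneg_left (le_trans ?_ (le_setIntegral_radialProfile ht1)) hc0.le
    rw [div_mul_eq_mul_div, mul_div_assoc]
    gcongr
    linarith
  · refine mul_le_mul_of_nonneg_left ((setIntegral_radialProfile_le ht1).trans ?_) hc0.le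
    linarith
end
end

section
/- Let n ≥ 3. There exist constants 0 < C₁ ≤ C₂ < ∞ and T > 0 such that for all t ≥ T: C₁ t^{−n/2+1} ≤ ∫_{ℝⁿ} e^{−t|ξ|²} | sin(t|ξ|)/|ξ| |² dξ ≤ C₂ t^{−n/2+1}. -/
open MeasureTheory Filter

noncomputable section

theorem integrableOn_Ioi_pow_mul_exp_neg_sq (m : ℕ) :
    IntegrableOn (fun s : ℝ => s ^ m * Real.exp (-s ^ 2)) (Set.Ioi 0) := by
  simpa using (integrable_rpow_mul_exp_neg_mul_sq one_pos
    (neg_one_lt_zero.trans_le (Nat.cast_nonneg (α := ℝ) m))).integrableOn (s := Set.Ioi 0)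

theorem integrableOn_Ioi_pow_mul_exp_neg_sq_mul_sin_sq (m : ℕ) (τ : ℝ) :
    IntegrableOn (fun s : ℝ => s ^ m * Real.exp (-s ^ 2) * Real.sin (τ * s) ^ 2) (Set.Ioi 0) := by
  refine (integrableOn_Ioi_pow_mul_exp_neg_sq m).mono' (by fun_prop) ?_
  filter_upwards [ae_restrict_mem measurableSet_Ioi] with s hs
  have hs' : 0 < s := hs
  rw [Real.norm_of_nonneg (by positivity)]
  exact mul_le_of_le_one_right (by positivity) (Real.sin_sq_le_one _)

theorem integral_Ioi_pow_mul_exp_neg_sq_mul_sin_sq_le (m : ℕ) (τ : ℝ) :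
    ∫ s in Set.Ioi (0 : ℝ), s ^ m * Real.exp (-s ^ 2) * Real.sin (τ * s) ^ 2 ≤
      ∫ s in Set.Ioi (0 : ℝ), s ^ m * Real.exp (-s ^ 2) := by
  refine setIntegral_mono_on (integrableOn_Ioi_pow_mul_exp_neg_sq_mul_sin_sq m τ)
    (integrableOn_Ioi_pow_mul_exp_neg_sq m) measurableSet_Ioi fun s hs => ?_
  have hs' : 0 < s := hs
  exact mul_le_of_le_one_right (by positivity) (Real.sin_sq_le_one _)

theorem quarter_le_integral_sin_mul_sq {τ : ℝ} (hτ : 2 ≤ τ) :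
    1 / 4 ≤ ∫ s in (1 : ℝ)..2, Real.sin (τ * s) ^ 2 := by
  have hτ0 : 0 < τ := by linarith
  rw [intervalIntegral.integral_comp_mul_left (fun x => Real.sin x ^ 2) hτ0.ne', integral_sin_sq,
    smul_eq_mul, inv_mul_eq_div, le_div_iff₀ hτ0]
  nlinarith [sq_nonneg (Real.sin (τ * 1) + Real.cos (τ * 1)), Real.sin_sq_add_cos_sq (τ * 1),
    sq_nonneg (Real.sin (τ * 2) - Real.cos (τ * 2)), Real.sin_sq_add_cos_sq (τ * 2)]

theorem le_integral_Ioi_pow_mul_exp_neg_sq_mul_sin_sq (m : ℕ) {τ : ℝ} (hτ : 2 ≤ τ) :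
    Real.exp (-4) / 4 ≤
      ∫ s in Set.Ioi (0 : ℝ), s ^ m * Real.exp (-s ^ 2) * Real.sin (τ * s) ^ 2 := by
  have hsub : Set.Ioc (1 : ℝ) 2 ⊆ Set.Ioi 0 := fun s hs => one_pos.trans hs.1
  calc Real.exp (-4) / 4 ≤ Real.exp (-4) * ∫ s in (1 : ℝ)..2, Real.sin (τ * s) ^ 2 := by
        nlinarith [quarter_le_integral_sin_mul_sq hτ, Real.exp_pos (-4)]
    _ = ∫ s in Set.Ioc (1 : ℝ) 2, Real.exp (-4) * Real.sin (τ * s) ^ 2 := by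
        rw [intervalIntegral.integral_of_le one_le_two, integral_const_mul]
    _ ≤ ∫ s in Set.Ioc (1 : ℝ) 2, s ^ m * Real.exp (-s ^ 2) * Real.sin (τ * s) ^ 2 := by
        refine setIntegral_mono_on
          (Continuous.integrableOn_Ioc (by fun_prop))
          ((integrableOn_Ioi_pow_mul_exp_neg_sq_mul_sin_sq m τ).mono_set hsub)
          measurableSet_Ioc fun s hs => ?_
        have h1 : Real.exp (-4) ≤ Real.exp (-s ^ 2) :=
          Real.exp_le_exp.2 (by nlinarith [hs.1, hs.2])
        have h2 : 1 ≤ s ^ m := one_le_pow₀ hs.1.le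
        gcongr
        nlinarith [Real.exp_pos (-s ^ 2)]
    _ ≤ _ := by
        refine setIntegral_mono_set (integrableOn_Ioi_pow_mul_exp_neg_sq_mul_sin_sq m τ) ?_
          hsub.eventuallyLE
        filter_upwards [ae_restrict_mem measurableSet_Ioi] with s hs
        have hs' : 0 < s := hs
        show 0 ≤ s ^ m * Real.exp (-s ^ 2) * Real.sin (τ * s) ^ 2
        positivity

/-- Polar coordinates followed by the substitution `s = √t r`. -/
theorem integral_exp_neg_mul_sin_div_norm_sq (m : ℕ) {t : ℝ} (ht : 0 < t) :
    ∫ ξ : Rn (m + 3), Real.exp (-(t * ‖ξ‖ ^ 2)) * (Real.sin (t * ‖ξ‖) / ‖ξ‖) ^ 2 =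
      (m + 3) * volume.real (Metric.ball (0 : Rn (m + 3)) 1) *
        (∫ s in Set.Ioi (0 : ℝ), s ^ m * Real.exp (-s ^ 2) * Real.sin (√t * s) ^ 2) *
        t ^ (-((m + 3 : ℕ) : ℝ) / 2 + 1) := by
  have hτ : 0 < √t := Real.sqrt_pos.2 ht
  have hsq : √t ^ 2 = t := Real.sq_sqrt ht.le
  have hpow : t ^ (-((m + 3 : ℕ) : ℝ) / 2 + 1) = (√t ^ (m + 1))⁻¹ := by
    rw [← Real.rpow_natCast (√t), Real.sqrt_eq_rpow, ← Real.rpow_mul ht.le, ← Real.rpow_neg ht.le]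
    congr 1
    push_cast
    ring
  have hrad : ∫ r in Set.Ioi (0 : ℝ),
      r ^ (m + 2) * (Real.exp (-(t * r ^ 2)) * (Real.sin (t * r) / r) ^ 2) =
      (√t ^ (m + 1))⁻¹ *
        ∫ s in Set.Ioi (0 : ℝ), s ^ m * Real.exp (-s ^ 2) * Real.sin (√t * s) ^ 2 := by
    have h := integral_comp_mul_left_Ioi
      (fun s : ℝ => s ^ m * Real.exp (-s ^ 2) * Real.sin (√t * s) ^ 2) 0 hτ
    rw [mul_zero, smul_eq_mul] at h
    rw [pow_succ, mul_inv, mul_assoc, ← h, ← integral_const_mul]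
    refine setIntegral_congr_fun measurableSet_Ioi fun r hr => ?_
    have hr' : r ≠ 0 := ne_of_gt hr
    simp only [mul_pow, hsq, ← mul_assoc, Real.mul_self_sqrt ht.le]
    field_simp
    ring
  have h := integral_fun_norm_addHaar (volume : Measure (Rn (m + 3)))
    (fun r : ℝ => Real.exp (-(t * r ^ 2)) * (Real.sin (t * r) / r) ^ 2)
  rw [h, hpow]
  simp only [finrank_euclideanSpace, Fintype.card_fin, smul_eq_mul, nsmul_eq_mul,
    show m + 3 - 1 = m + 2 from rfl]
  rw [hrad]
  push_cast
  ring

theorem stmt19 (n : ℕ) (hn : 3 ≤ n) :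
    ∃ C₁ C₂ : ℝ, 0 < C₁ ∧ C₁ ≤ C₂ ∧ ∃ T : ℝ, 0 < T ∧ ∀ t : ℝ, T ≤ t →
      C₁ * t ^ (-(n : ℝ) / 2 + 1) ≤
          (∫ ξ : Rn n, Real.exp (-(t * ‖ξ‖ ^ 2)) * (Real.sin (t * ‖ξ‖) / ‖ξ‖) ^ 2) ∧
        (∫ ξ : Rn n, Real.exp (-(t * ‖ξ‖ ^ 2)) * (Real.sin (t * ‖ξ‖) / ‖ξ‖) ^ 2) ≤
          C₂ * t ^ (-(n : ℝ) / 2 + 1) := by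
  obtain ⟨m, rfl⟩ := Nat.exists_eq_add_of_le' hn
  have hω : 0 < volume.real (Metric.ball (0 : Rn (m + 3)) 1) :=
    ENNReal.toReal_pos (Metric.measure_ball_pos _ _ one_pos).ne' measure_ball_lt_top.ne
  refine ⟨(m + 3) * volume.real (Metric.ball (0 : Rn (m + 3)) 1) * (Real.exp (-4) / 4),
    (m + 3) * volume.real (Metric.ball (0 : Rn (m + 3)) 1) *
      ∫ s in Set.Ioi (0 : ℝ), s ^ m * Real.exp (-s ^ 2), by positivity, ?_, 4, by norm_num,
    fun t ht => ?_⟩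
  · gcongr
    exact (le_integral_Ioi_pow_mul_exp_neg_sq_mul_sin_sq m le_rfl).trans
      (integral_Ioi_pow_mul_exp_neg_sq_mul_sin_sq_le m 2)
  · have ht0 : 0 < t := by linarith
    have hτ : 2 ≤ √t := Real.le_sqrt_of_sq_le (by linarith)
    rw [integral_exp_neg_mul_sin_div_norm_sq m ht0]
    constructor
    · gcongr
      exact le_integral_Ioi_pow_mul_exp_neg_sq_mul_sin_sq m hτ
    · exact mul_le_mul_of_nonneg_right (mul_le_mul_of_nonneg_left
        (integral_Ioi_pow_mul_exp_neg_sq_mul_sin_sq_le m _) (by positivity)) (by positivity)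
end
end
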